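/- Fix k ∈ ℤ. The following are equivalent: (i) the double complex satisfies the d'd''-lemma at every (p,q) with p+q = k; (ii) ker d' ∩ ker d'' ∩ Im d ∩ A^k = Im d'd'' ∩ A^k; (iii) ker d'd'' ∩ A^{k-1} = (ker d + Im d' + Im d'') ∩ A^{k-1}. (Condition (ii) says that the natural map ⊕_{p+q=k} H_{BC}^{p,q} → H^k is injective; condition (iii) says that the natural map H^{k-1} → ⊕_{p+q=k-1} H_A^{p,q} is surjective.) -/

import Mathlib

open Submodule

/-- A double complex of complex vector spaces, realized as an internally bigraded
module `W = ⊕_{p,q} A p q` together with global differentials `d'`, `d''` of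
bidegrees `(1,0)` and `(0,1)` satisfying `d'∘d' = 0`, `d''∘d'' = 0` and
`d'∘d'' + d''∘d' = 0`. -/
structure BiComplex (W : Type*) [AddCommGroup W] [Module ℂ W] where
  A : ℤ → ℤ → Submodule ℂ W
  d' : W →ₗ[ℂ] W
  d'' : W →ₗ[ℂ] W
  internal : DirectSum.IsInternal (fun pq : ℤ × ℤ => A pq.1 pq.2)
  map_d' : ∀ p q : ℤ, (A p q).map d' ≤ A (p + 1) q
  map_d'' : ∀ p q : ℤ, (A p q).map d'' ≤ A p (q + 1)
  d'_sq : d' ∘ₗ d' = 0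
  d''_sq : d'' ∘ₗ d'' = 0
  anticomm : d' ∘ₗ d'' + d'' ∘ₗ d' = 0

namespace BiComplex

variable {W : Type*} [AddCommGroup W] [Module ℂ W] (C : BiComplex W)

/-- `ker d' ∩ A^{p,q}` : the kernel of `d' : A^{p,q} → A^{p+1,q}`. -/
def kerd' (p q : ℤ) : Submodule ℂ W := LinearMap.ker C.d' ⊓ C.A p q

/-- `ker d'' ∩ A^{p,q}` : the kernel of `d'' : A^{p,q} → A^{p,q+1}`. -/
def kerd'' (p q : ℤ) : Submodule ℂ W := LinearMap.ker C.d'' ⊓ C.A p q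

/-- `Im d' ∩ A^{p,q} = d'(A^{p-1,q})`. -/
def imd' (p q : ℤ) : Submodule ℂ W := (C.A (p - 1) q).map C.d'

/-- `Im d'' ∩ A^{p,q} = d''(A^{p,q-1})`. -/
def imd'' (p q : ℤ) : Submodule ℂ W := (C.A p (q - 1)).map C.d''

/-- `Im d'd'' ∩ A^{p,q} = (d'∘d'')(A^{p-1,q-1})`. -/
def imd'd'' (p q : ℤ) : Submodule ℂ W := (C.A (p - 1) (q - 1)).map (C.d' ∘ₗ C.d'')

/-- `ker d'd'' ∩ A^{p,q}` : the kernel of `d'∘d'' : A^{p,q} → A^{p+1,q+1}`. -/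
def kerd'd'' (p q : ℤ) : Submodule ℂ W := LinearMap.ker (C.d' ∘ₗ C.d'') ⊓ C.A p q

/-- The `d'd''`-lemma at `(p,q)`:
`Im d' ∩ ker d'' ∩ A^{p,q} = ker d' ∩ Im d'' ∩ A^{p,q} = Im d'd'' ∩ A^{p,q}`. -/
def DDLemmaAt (p q : ℤ) : Prop :=
  C.imd' p q ⊓ C.kerd'' p q = C.imd'd'' p q ∧ C.kerd' p q ⊓ C.imd'' p q = C.imd'd'' p q

/-- The total-degree piece `A^k = ⊕_{p+q=k} A^{p,q}`. -/
def Atot (k : ℤ) : Submodule ℂ W := ⨆ p : ℤ, C.A p (k - p)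

/-- The total differential `d = d' + d''`. -/
def dtot : W →ₗ[ℂ] W := C.d' + C.d''

/-- `ker d ∩ A^k` : the kernel of `d : A^k → A^{k+1}`. -/
def kerdTot (k : ℤ) : Submodule ℂ W := LinearMap.ker C.dtot ⊓ C.Atot k

/-- `Im d ∩ A^k = d(A^{k-1})`. -/
def imdTot (k : ℤ) : Submodule ℂ W := (C.Atot (k - 1)).map C.dtot

/-- `ker d' ∩ ker d'' ∩ A^k = ⊕_{p+q=k} (ker d' ∩ ker d'' ∩ A^{p,q})`. -/
def kerd'kerd''Tot (k : ℤ) : Submodule ℂ W :=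
  ⨆ p : ℤ, (C.kerd' p (k - p) ⊓ C.kerd'' p (k - p))

/-- `Im d'd'' ∩ A^k = ⊕_{p+q=k} (Im d'd'' ∩ A^{p,q})`. -/
def imd'd''Tot (k : ℤ) : Submodule ℂ W := ⨆ p : ℤ, C.imd'd'' p (k - p)

/-- `ker d'd'' ∩ A^k = ⊕_{p+q=k} (ker d'd'' ∩ A^{p,q})`. -/
def kerd'd''Tot (k : ℤ) : Submodule ℂ W := ⨆ p : ℤ, C.kerd'd'' p (k - p)

/-- `Im d' ∩ A^k = ⊕_{p+q=k} (Im d' ∩ A^{p,q})`. -/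
def imd'Tot (k : ℤ) : Submodule ℂ W := ⨆ p : ℤ, C.imd' p (k - p)

/-- `Im d'' ∩ A^k = ⊕_{p+q=k} (Im d'' ∩ A^{p,q})`. -/
def imd''Tot (k : ℤ) : Submodule ℂ W := ⨆ p : ℤ, C.imd'' p (k - p)

/-- The double complex is totally bounded: `A^{p,q} = 0` for `|p| > N` or `|q| > N`. -/
def TotallyBounded : Prop :=
  ∃ N : ℕ, ∀ p q : ℤ, ((N : ℤ) < |p| ∨ (N : ℤ) < |q|) → C.A p q = ⊥

end BiComplex

/-- The quotient vector space `S / T` of a submodule `S` by (the trace of) a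
submodule `T ≤ S`. -/
abbrev quotSub {W : Type*} [AddCommGroup W] [Module ℂ W] (S T : Submodule ℂ W) :=
  S ⧸ (Submodule.comap S.subtype T)

namespace BiComplex

variable {W : Type*} [AddCommGroup W] [Module ℂ W] (C : BiComplex W)

/-- The bidegree-`(p,q)` component of an element, as an endomorphism of `W`. -/
noncomputable def proj (p q : ℤ) : W →ₗ[ℂ] W :=
  (C.A p q).subtype ∘ₗ
    DirectSum.component ℂ (ℤ × ℤ) (fun i => C.A i.1 i.2) (p, q) ∘ₗ
      (LinearEquiv.ofBijective (DirectSum.coeLinearMap fun i : ℤ × ℤ => C.A i.1 i.2)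
        C.internal).symm.toLinearMap

lemma proj_mem (p q : ℤ) (x : W) : C.proj p q x ∈ C.A p q :=
  Subtype.property _

lemma proj_of_mem {p q : ℤ} {x : W} (hx : x ∈ C.A p q) (r s : ℤ) :
    C.proj r s x = if p = r ∧ q = s then x else 0 := by
  have h : (LinearEquiv.ofBijective (DirectSum.coeLinearMap fun i : ℤ × ℤ => C.A i.1 i.2)
      C.internal).symm x = DirectSum.lof ℂ (ℤ × ℤ) (fun i => C.A i.1 i.2) (p, q) ⟨x, hx⟩ := by
    rw [LinearEquiv.symm_apply_eq]
    exact (DirectSum.coeLinearMap_lof (fun i : ℤ × ℤ => C.A i.1 i.2) (p, q) ⟨x, hx⟩).symm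
  simp only [proj, LinearMap.comp_apply, LinearEquiv.coe_coe, h]
  split_ifs with hpq
  · obtain ⟨rfl, rfl⟩ := hpq
    simp [DirectSum.component.lof_self]
  · have hne : ((p, q) : ℤ × ℤ) ≠ (r, s) := fun e => hpq (Prod.mk.inj e)
    exact congrArg Subtype.val
      (DirectSum.of_eq_of_ne (β := fun i : ℤ × ℤ => C.A i.1 i.2) (p, q) (r, s) ⟨x, hx⟩ hne.symm)

lemma proj_self {p q : ℤ} {x : W} (hx : x ∈ C.A p q) : C.proj p q x = x := by
  simp [C.proj_of_mem hx]

lemma iSup_A : ⨆ i : ℤ × ℤ, C.A i.1 i.2 = ⊤ :=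
  C.internal.submodule_iSup_eq_top

lemma mem_A_congr {p q r s : ℤ} {x : W} (hx : x ∈ C.A p q) (hp : p = r) (hq : q = s) :
    x ∈ C.A r s :=
  hp ▸ hq ▸ hx

lemma d'_mem {p q : ℤ} {x : W} (hx : x ∈ C.A p q) : C.d' x ∈ C.A (p + 1) q :=
  C.map_d' p q (mem_map_of_mem hx)

lemma d''_mem {p q : ℤ} {x : W} (hx : x ∈ C.A p q) : C.d'' x ∈ C.A p (q + 1) :=
  C.map_d'' p q (mem_map_of_mem hx)

lemma proj_d' (p q : ℤ) (x : W) : C.proj p q (C.d' x) = C.d' (C.proj (p - 1) q x) := by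
  have hx : x ∈ ⨆ i : ℤ × ℤ, C.A i.1 i.2 := C.iSup_A ▸ mem_top
  induction hx using Submodule.iSup_induction' with
  | mem i y hy =>
    rw [C.proj_of_mem hy, C.proj_of_mem (C.d'_mem hy)]
    simp only [eq_sub_iff_add_eq]
    split_ifs <;> simp
  | zero => simp
  | add y z _ _ hy hz => simp [hy, hz]

lemma proj_d'' (p q : ℤ) (x : W) : C.proj p q (C.d'' x) = C.d'' (C.proj p (q - 1) x) := by
  have hx : x ∈ ⨆ i : ℤ × ℤ, C.A i.1 i.2 := C.iSup_A ▸ mem_top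
  induction hx using Submodule.iSup_induction' with
  | mem i y hy =>
    rw [C.proj_of_mem hy, C.proj_of_mem (C.d''_mem hy)]
    simp only [eq_sub_iff_add_eq]
    split_ifs <;> simp
  | zero => simp
  | add y z _ _ hy hz => simp [hy, hz]

lemma d'_d' (x : W) : C.d' (C.d' x) = 0 := LinearMap.congr_fun C.d'_sq x

lemma d''_d'' (x : W) : C.d'' (C.d'' x) = 0 := LinearMap.congr_fun C.d''_sq x

lemma d''_d' (x : W) : C.d'' (C.d' x) = -C.d' (C.d'' x) :=
  eq_neg_of_add_eq_zero_right (LinearMap.congr_fun C.anticomm x)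

lemma dtot_apply (x : W) : C.dtot x = C.d' x + C.d'' x := rfl

lemma mem_Atot {p q k : ℤ} (h : p + q = k) {x : W} (hx : x ∈ C.A p q) : x ∈ C.Atot k :=
  mem_iSup_of_mem (p := fun p => C.A p (k - p)) p (C.mem_A_congr hx rfl (by omega))

lemma proj_mem_of_mem_iSup {k : ℤ} {S : ℤ → Submodule ℂ W} (hS : ∀ p, S p ≤ C.A p (k - p))
    {x : W} (hx : x ∈ ⨆ p, S p) (p : ℤ) : C.proj p (k - p) x ∈ S p := by
  induction hx using Submodule.iSup_induction' with
  | mem i y hy =>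
    rw [C.proj_of_mem (hS i hy)]
    split_ifs with h
    · exact h.1 ▸ hy
    · exact zero_mem _
  | zero => simp
  | add y z _ _ hy hz => simpa using add_mem hy hz

lemma mem_iSup_of_proj_mem {k : ℤ} {S : ℤ → Submodule ℂ W} {x : W} (hx : x ∈ C.Atot k)
    (h : ∀ p, C.proj p (k - p) x ∈ S p) : x ∈ ⨆ p, S p := by
  obtain ⟨f, hf, rfl⟩ := (mem_iSup_iff_exists_finsupp _ _).1 hx
  refine sum_mem fun p _ => mem_iSup_of_mem p ?_
  suffices hp : C.proj p (k - p) (f.sum fun _ y => y) = f p from hp ▸ h p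
  rw [Finsupp.sum, map_sum, Finset.sum_eq_single p]
  · exact C.proj_self (hf p)
  · intro r _ hr
    rw [C.proj_of_mem (hf r), if_neg fun e => hr e.1]
  · intro hp
    simp [Finsupp.notMem_support_iff.1 hp]

lemma imd'd''_le (p q : ℤ) : C.imd'd'' p q ≤ C.A p q := by
  rintro _ ⟨b, hb, rfl⟩
  exact C.mem_A_congr (C.d'_mem (C.d''_mem hb)) (by omega) (by omega)

lemma imd'_le (p q : ℤ) : C.imd' p q ≤ C.A p q := by
  rintro _ ⟨b, hb, rfl⟩
  exact C.mem_A_congr (C.d'_mem hb) (by omega) rfl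

lemma imd''_le (p q : ℤ) : C.imd'' p q ≤ C.A p q := by
  rintro _ ⟨b, hb, rfl⟩
  exact C.mem_A_congr (C.d''_mem hb) rfl (by omega)

lemma imd'd''_le_imd'_inf_kerd'' (p q : ℤ) :
    C.imd'd'' p q ≤ C.imd' p q ⊓ C.kerd'' p q := by
  intro x hx
  have hxA := C.imd'd''_le p q hx
  obtain ⟨b, hb, rfl⟩ := hx
  refine ⟨⟨C.d'' b, C.mem_A_congr (C.d''_mem hb) rfl (by omega), rfl⟩, ?_, hxA⟩
  simp [d''_d', d''_d'']

lemma imd'd''_le_kerd'_inf_imd'' (p q : ℤ) :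
    C.imd'd'' p q ≤ C.kerd' p q ⊓ C.imd'' p q := by
  intro x hx
  have hxA := C.imd'd''_le p q hx
  obtain ⟨b, hb, rfl⟩ := hx
  refine ⟨⟨?_, hxA⟩, ⟨-C.d' b, neg_mem (C.mem_A_congr (C.d'_mem hb) (by omega) rfl), ?_⟩⟩
  · simp [d'_d']
  · rw [map_neg, d''_d', neg_neg, LinearMap.comp_apply]

/-- The `d'd''`-lemma in total degree `k`, phrased on homogeneous elements of total degree
`k - 1`. -/
lemma forall_ddLemmaAt_iff (k : ℤ) :
    (∀ p q : ℤ, p + q = k → C.DDLemmaAt p q) ↔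
      ∀ p q : ℤ, p + q = k - 1 → ∀ a ∈ C.A p q, C.d' (C.d'' a) = 0 →
        C.d' a ∈ C.imd'd'' (p + 1) q ∧ C.d'' a ∈ C.imd'd'' p (q + 1) := by
  constructor
  · intro h p q hpq a ha h0
    rw [← (h (p + 1) q (by omega)).1, ← (h p (q + 1) (by omega)).2]
    refine ⟨⟨⟨a, C.mem_A_congr ha (by omega) rfl, rfl⟩, ?_, C.d'_mem ha⟩,
      ⟨h0, C.d''_mem ha⟩, ⟨a, C.mem_A_congr ha rfl (by omega), rfl⟩⟩
    simp [d''_d', h0]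
  · intro h p q hpq
    refine ⟨le_antisymm ?_ (C.imd'd''_le_imd'_inf_kerd'' p q),
      le_antisymm ?_ (C.imd'd''_le_kerd'_inf_imd'' p q)⟩
    · rintro _ ⟨⟨a, ha, rfl⟩, h0, -⟩
      have h0' : C.d' (C.d'' a) = 0 := by simpa [d''_d'] using h0
      simpa using (h (p - 1) q (by omega) a ha h0').1
    · rintro _ ⟨⟨h0, -⟩, ⟨a, ha, rfl⟩⟩
      simpa using (h p (q - 1) (by omega) a ha h0).2

lemma imd'd''Tot_le (k : ℤ) : C.imd'd''Tot k ≤ C.kerd'kerd''Tot k ⊓ C.imdTot k := by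
  refine iSup_le fun p x hx => ⟨mem_iSup_of_mem p
    ⟨(C.imd'd''_le_kerd'_inf_imd'' _ _ hx).1, (C.imd'd''_le_imd'_inf_kerd'' _ _ hx).2⟩, ?_⟩
  obtain ⟨b, hb, rfl⟩ := hx
  refine ⟨C.d'' b, C.mem_Atot (by omega) (C.d''_mem hb), ?_⟩
  simp [d''_d'', dtot_apply]

/-- If `d a` lies in `Im d'd''` for a homogeneous `a`, then so do `d' a` and `d'' a`. -/
lemma d'_mem_and_d''_mem_of_dtot_mem {k p q : ℤ} (hpq : p + q = k - 1) {a : W}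
    (ha : a ∈ C.A p q) (h : C.dtot a ∈ C.imd'd''Tot k) :
    C.d' a ∈ C.imd'd'' (p + 1) q ∧ C.d'' a ∈ C.imd'd'' p (q + 1) := by
  have key := C.proj_mem_of_mem_iSup (fun p => C.imd'd''_le p (k - p)) h
  have h₁ := key (p + 1)
  have h₂ := key p
  rw [show k - (p + 1) = q by omega] at h₁
  rw [show k - p = q + 1 by omega] at h₂
  rw [dtot_apply, map_add, C.proj_of_mem (C.d'_mem ha), C.proj_of_mem (C.d''_mem ha)] at h₁ h₂
  simp at h₁ h₂
  exact ⟨h₁, h₂⟩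

lemma ddLemma_iff_kerd'kerd''Tot_inf_imdTot (k : ℤ) :
    (∀ p q : ℤ, p + q = k → C.DDLemmaAt p q) ↔
      C.kerd'kerd''Tot k ⊓ C.imdTot k = C.imd'd''Tot k := by
  rw [forall_ddLemmaAt_iff]
  constructor
  · refine fun h => le_antisymm ?_ (C.imd'd''Tot_le k)
    rintro _ ⟨hu, ⟨a, ha, rfl⟩⟩
    have hker := C.proj_mem_of_mem_iSup (k := k)
      (fun p => (inf_le_left.trans inf_le_right : C.kerd' p (k - p) ⊓ C.kerd'' p (k - p) ≤ _)) hu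
    refine C.mem_iSup_of_proj_mem
      ((iSup_mono fun p => inf_le_left.trans inf_le_right : C.kerd'kerd''Tot k ≤ _) hu)
      fun p => ?_
    have hp := hker p
    rw [dtot_apply, map_add, proj_d', proj_d''] at hp ⊢
    obtain ⟨⟨h', -⟩, ⟨h'', -⟩⟩ := hp
    refine add_mem ?_ ?_
    · have := (h (p - 1) (k - p) (by omega) _ (C.proj_mem _ _ a)
        (by simpa [d''_d', d''_d''] using h'')).1
      simpa using this
    · have := (h p (k - p - 1) (by omega) _ (C.proj_mem _ _ a)
        (by simpa [d'_d'] using h')).2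
      simpa using this
  · intro h p q hpq a ha h0
    refine C.d'_mem_and_d''_mem_of_dtot_mem hpq ha (h ▸ ⟨?_, ⟨a, C.mem_Atot hpq ha, rfl⟩⟩)
    refine add_mem (mem_iSup_of_mem (p + 1) ?_) (mem_iSup_of_mem p ?_)
    · have hA := C.mem_A_congr (C.d'_mem ha) rfl (show q = k - (p + 1) by omega)
      exact ⟨⟨C.d'_d' a, hA⟩, by simp [d''_d', h0], hA⟩
    · have hA := C.mem_A_congr (C.d''_mem ha) rfl (show q + 1 = k - p by omega)
      exact ⟨⟨h0, hA⟩, C.d''_d'' a, hA⟩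

lemma kerdTot_sup_imd'Tot_sup_imd''Tot_le (k : ℤ) :
    C.kerdTot k ⊔ C.imd'Tot k ⊔ C.imd''Tot k ≤ C.kerd'd''Tot k := by
  refine sup_le (sup_le ?_ ?_) ?_
  · rintro a ⟨h0, ha⟩
    refine C.mem_iSup_of_proj_mem ha fun p => ⟨?_, C.proj_mem _ _ a⟩
    have h : C.d' (C.d'' a) = 0 := by
      have := congrArg C.d' (LinearMap.mem_ker.1 h0)
      simpa [dtot_apply, d'_d'] using this
    have := congrArg (C.proj (p + 1) (k - p + 1)) h
    simpa [proj_d', proj_d''] using this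
  · refine iSup_mono fun p x hx => ⟨?_, C.imd'_le _ _ hx⟩
    obtain ⟨b, -, rfl⟩ := hx
    simp [d''_d', d'_d']
  · refine iSup_mono fun p x hx => ⟨?_, C.imd''_le _ _ hx⟩
    obtain ⟨b, -, rfl⟩ := hx
    simp [d''_d'']

lemma d'_d''_mem_imd'd''Tot {k : ℤ} {x : W} (hx : x ∈ C.Atot (k - 2)) :
    C.d' (C.d'' x) ∈ C.imd'd''Tot k := by
  induction hx using Submodule.iSup_induction' with
  | mem i y hy =>
    exact mem_iSup_of_mem (i + 1) ⟨y, C.mem_A_congr hy (by omega) (by omega), rfl⟩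
  | zero => simp
  | add y z _ _ hy hz => simpa using add_mem hy hz

lemma exists_of_mem_imd'Tot {k : ℤ} {x : W} (hx : x ∈ C.imd'Tot k) :
    ∃ b ∈ C.Atot (k - 1), C.d' b = x := by
  have h : C.imd'Tot k ≤ (C.Atot (k - 1)).map C.d' :=
    iSup_le fun p => map_mono fun b hb => C.mem_Atot (by omega) hb
  exact h hx

lemma exists_of_mem_imd''Tot {k : ℤ} {x : W} (hx : x ∈ C.imd''Tot k) :
    ∃ b ∈ C.Atot (k - 1), C.d'' b = x := by
  have h : C.imd''Tot k ≤ (C.Atot (k - 1)).map C.d'' :=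
    iSup_le fun p => map_mono fun b hb => C.mem_Atot (by omega) hb
  exact h hx

lemma ddLemma_iff_kerd'd''Tot_eq (k : ℤ) :
    (∀ p q : ℤ, p + q = k → C.DDLemmaAt p q) ↔
      C.kerd'd''Tot (k - 1) =
        C.kerdTot (k - 1) ⊔ C.imd'Tot (k - 1) ⊔ C.imd''Tot (k - 1) := by
  rw [forall_ddLemmaAt_iff]
  constructor
  · refine fun h => le_antisymm (iSup_le fun p => ?_)
      (C.kerdTot_sup_imd'Tot_sup_imd''Tot_le (k - 1))
    rintro a ⟨h0, ha⟩
    obtain ⟨⟨c, hc, hca⟩, ⟨b, hb, hba⟩⟩ := h p (k - 1 - p) (by omega) a ha h0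
    rw [LinearMap.comp_apply] at hca hba
    have hb' : C.d' b ∈ C.imd' p (k - 1 - p) := ⟨b, C.mem_A_congr hb rfl (by omega), rfl⟩
    have hc' : C.d'' c ∈ C.imd'' p (k - 1 - p) := ⟨c, C.mem_A_congr hc (by omega) rfl, rfl⟩
    have hz : a + C.d' b - C.d'' c ∈ C.kerdTot (k - 1) := by
      refine ⟨?_, C.mem_Atot (by omega)
        (sub_mem (add_mem ha (C.imd'_le _ _ hb')) (C.imd''_le _ _ hc'))⟩
      simp [dtot_apply, d'_d', d''_d'', d''_d', hca, hba]
    rw [show a = a + C.d' b - C.d'' c + -C.d' b + C.d'' c by abel]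
    exact add_mem_sup (add_mem_sup hz (neg_mem (mem_iSup_of_mem p hb'))) (mem_iSup_of_mem p hc')
  · intro h p q hpq a ha h0
    refine C.d'_mem_and_d''_mem_of_dtot_mem hpq ha ?_
    have hmem : a ∈ C.kerd'd''Tot (k - 1) :=
      mem_iSup_of_mem p ⟨h0, C.mem_A_congr ha rfl (by omega)⟩
    rw [h] at hmem
    obtain ⟨_, hy, _, hc, rfl⟩ := mem_sup.1 hmem
    obtain ⟨z, ⟨hz, -⟩, _, hb, rfl⟩ := mem_sup.1 hy
    obtain ⟨b, hb', rfl⟩ := C.exists_of_mem_imd'Tot hb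
    obtain ⟨c, hc', rfl⟩ := C.exists_of_mem_imd''Tot hc
    rw [sub_sub, one_add_one_eq_two] at hb' hc'
    have hd : C.dtot (z + C.d' b + C.d'' c) = C.d' (C.d'' (c - b)) := by
      rw [map_add, map_add, LinearMap.mem_ker.1 hz]
      simp [dtot_apply, d'_d', d''_d'', d''_d', sub_eq_neg_add]
    rw [hd]
    exact C.d'_d''_mem_imd'd''Tot (sub_mem hc' hb')

end BiComplex

/-- Fix `k`.  The `d'd''`-lemma holds at every `(p,q)` with
`p+q = k` iff `ker d' ∩ ker d'' ∩ Im d ∩ A^k = Im d'd'' ∩ A^k` (injectivity of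
`⊕_{p+q=k} H_BC^{p,q} → H^k`) iff
`ker d'd'' ∩ A^{k-1} = (ker d + Im d' + Im d'') ∩ A^{k-1}` (surjectivity of
`H^{k-1} → ⊕_{p+q=k-1} H_A^{p,q}`). -/
theorem bicomplex_ddlemma_iff_phi_inj_iff_psi_surj
    {W : Type*} [AddCommGroup W] [Module ℂ W] (C : BiComplex W) (k : ℤ) :
    ((∀ p q : ℤ, p + q = k → C.DDLemmaAt p q) ↔
      C.kerd'kerd''Tot k ⊓ C.imdTot k = C.imd'd''Tot k) ∧
    ((∀ p q : ℤ, p + q = k → C.DDLemmaAt p q) ↔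
      C.kerd'd''Tot (k - 1) =
        C.kerdTot (k - 1) ⊔ C.imd'Tot (k - 1) ⊔ C.imd''Tot (k - 1)) := by
  exact ⟨C.ddLemma_iff_kerd'kerd''Tot_inf_imdTot k, C.ddLemma_iff_kerd'd''Tot_eq k⟩
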